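/- arXiv:1112.3219 — 5 statements merged into one kernel-verified Lean document; each statement's English description precedes it below -/
import Mathlib

section
/- There exist polynomials a, a*, b ∈ ℂ[z] (depending on p, q, r and d) such that for all z ∈ ℂ and all w ∈ ℂ with w ≠ 0: det( j(w) − z·I ) = R·w² + a(z)·w + b(z) + a*(z)·w⁻¹ + R·w⁻², where R = ∏_{j=0}^{d−1} r_j; in particular, as a Laurent polynomial in w, det( j(w) − z·I ) has degree at most 2 and at least −2, and its coefficients at w² and w⁻² are both equal to R and do not depend on z. -/
noncomputable section

/-- The d×d Floquet matrix j(w) of a periodic five-diagonal matrix, with diagonal q,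
first off-diagonals given by p (with factor w on the wrap-around corner entries) and second
off-diagonals given by r (with factor w on the wrap-around corner entries). -/
def Jmat (d : ℕ) (q r : ℕ → ℝ) (p : ℕ → ℂ) (w : ℂ) : Matrix (Fin d) (Fin d) ℂ :=
  Matrix.of fun i j =>
    if (i : ℕ) = (j : ℕ) then (q i : ℂ)
    else if (j : ℕ) = (i : ℕ) + 1 then (starRingEnd ℂ) (p j)
    else if (i : ℕ) = d - 1 ∧ (j : ℕ) = 0 then (starRingEnd ℂ) (p 0) * w
    else if (i : ℕ) = (j : ℕ) + 1 then p i
    else if (i : ℕ) = 0 ∧ (j : ℕ) = d - 1 then p 0 / w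
    else if (j : ℕ) = (i : ℕ) + 2 then (r j : ℂ)
    else if (i : ℕ) = d - 2 ∧ (j : ℕ) = 0 then (r 0 : ℂ) * w
    else if (i : ℕ) = d - 1 ∧ (j : ℕ) = 1 then (r 1 : ℂ) * w
    else if (i : ℕ) = (j : ℕ) + 2 then (r i : ℂ)
    else if (i : ℕ) = 0 ∧ (j : ℕ) = d - 2 then (r 0 : ℂ) / w
    else if (i : ℕ) = 1 ∧ (j : ℕ) = d - 1 then (r 1 : ℂ) / w
    else 0

open Polynomial

namespace Floquet

/-- The power of `w` carried by the entry `(i, j)` of the Floquet matrix. -/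
def winding {d : ℕ} (i j : Fin d) : ℤ :=
  if (j : ℕ) + 2 < i then 1 else if (i : ℕ) + 2 < j then -1 else 0

/-- The signed diagonal of the periodic matrix on which the entry `(i, j)` lies. -/
def offset {d : ℕ} (i j : Fin d) : ℤ := (j : ℤ) - i + d * winding i j

/-- The entries of `Jmat d q r p w - z • 1`, as polynomials in `z`, with `w` set to `1`. -/
def coeffMatrix (d : ℕ) (q r : ℕ → ℝ) (p : ℕ → ℂ) : Matrix (Fin d) (Fin d) ℂ[X] :=
  fun i j => C (Jmat d q r p 1 i j) - if i = j then X else 0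

/-- The total power of `w` in the term of the determinant indexed by `σ`. -/
def totalWinding {d : ℕ} (σ : Equiv.Perm (Fin d)) : ℤ := ∑ i, winding (σ i) i

/-- The coefficient of `w ^ m` in the Leibniz expansion of the determinant. -/
def detCoeff (d : ℕ) (q r : ℕ → ℝ) (p : ℕ → ℂ) (m : ℤ) : ℂ[X] :=
  ∑ σ : Equiv.Perm (Fin d) with totalWinding σ = m,
    (Equiv.Perm.sign σ : ℤ) * ∏ i, coeffMatrix d q r p (σ i) i

variable {d : ℕ} {q r : ℕ → ℝ} {p : ℕ → ℂ}

lemma winding_cases (i j : Fin d) :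
    ((j : ℕ) + 2 < i ∧ winding i j = 1) ∨ ((i : ℕ) + 2 < j ∧ winding i j = -1) ∨
      ((i : ℕ) ≤ j + 2 ∧ (j : ℕ) ≤ i + 2 ∧ winding i j = 0) := by
  unfold winding
  split_ifs <;> omega

lemma Jmat_apply_eq (hd : 6 ≤ d) (w : ℂ) (i j : Fin d) :
    Jmat d q r p w i j = Jmat d q r p 1 i j * w ^ winding i j := by
  have hi := i.isLt
  have hj := j.isLt
  simp only [Jmat, Matrix.of_apply, ite_mul]
  rcases winding_cases i j with ⟨h, hw⟩ | ⟨h, hw⟩ | ⟨h, h', hw⟩ <;> rw [hw] <;>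
    repeat' refine ite_congr rfl (fun _ => ?_) fun _ => ?_
  all_goals first | (exfalso; omega) | simp [div_eq_mul_inv]

lemma sub_smul_one_apply_eq (hd : 6 ≤ d) (z w : ℂ) (i j : Fin d) :
    (Jmat d q r p w - z • (1 : Matrix (Fin d) (Fin d) ℂ)) i j =
      (coeffMatrix d q r p i j).eval z * w ^ winding i j := by
  rw [Matrix.sub_apply, Matrix.smul_apply, Jmat_apply_eq hd, Matrix.one_apply, coeffMatrix]
  by_cases h : i = j
  · subst h
    simp [winding]
  · simp [h]

lemma abs_offset_le (hd : 6 ≤ d) {i j : Fin d} (h : coeffMatrix d q r p i j ≠ 0) :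
    |offset i j| ≤ 2 := by
  have hi := i.isLt
  have hj := j.isLt
  contrapose! h
  rw [lt_abs] at h
  have hij : i ≠ j := by
    rintro rfl
    simp [offset, winding] at h
  simp only [coeffMatrix, hij, if_false, sub_zero, C_eq_zero, Jmat, Matrix.of_apply]
  rw [offset] at h
  rcases winding_cases i j with ⟨h₁, hw⟩ | ⟨h₁, hw⟩ | ⟨h₁, h₂, hw⟩ <;> rw [hw] at h <;>
    repeat' refine ite_eq_iff'.2 ⟨fun _ => ?_, fun _ => ?_⟩
  all_goals first | rfl | (exfalso; omega)

lemma coeffMatrix_of_offset_eq_two (hd : 6 ≤ d) {i j : Fin d} (h : offset i j = 2) :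
    coeffMatrix d q r p i j = C (r j : ℂ) := by
  have hi := i.isLt
  have hj := j.isLt
  have hij : i ≠ j := by
    rintro rfl
    simp [offset, winding] at h
  simp only [coeffMatrix, hij, if_false, sub_zero, Jmat, Matrix.of_apply]
  rw [offset] at h
  congr 1
  rcases winding_cases i j with ⟨h₁, hw⟩ | ⟨h₁, hw⟩ | ⟨h₁, h₂, hw⟩ <;> rw [hw] at h <;>
    repeat' refine ite_eq_iff'.2 ⟨fun _ => ?_, fun _ => ?_⟩
  all_goals first | (exfalso; omega) | simp_all

lemma coeffMatrix_of_offset_eq_neg_two (hd : 6 ≤ d) {i j : Fin d} (h : offset i j = -2) :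
    coeffMatrix d q r p i j = C (r i : ℂ) := by
  have hi := i.isLt
  have hj := j.isLt
  have hij : i ≠ j := by
    rintro rfl
    simp [offset, winding] at h
  simp only [coeffMatrix, hij, if_false, sub_zero, Jmat, Matrix.of_apply]
  rw [offset] at h
  congr 1
  rcases winding_cases i j with ⟨h₁, hw⟩ | ⟨h₁, hw⟩ | ⟨h₁, h₂, hw⟩ <;> rw [hw] at h <;>
    repeat' refine ite_eq_iff'.2 ⟨fun _ => ?_, fun _ => ?_⟩
  all_goals first | (exfalso; omega) | simp_all

lemma offset_swap (i j : Fin d) : offset j i = -offset i j := by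
  simp only [offset, winding]
  split_ifs <;> omega

lemma finRotate_sq_apply_eq_iff (hd : 6 ≤ d) (i j : Fin d) :
    (finRotate d ^ 2) i = j ↔ offset i j = 2 := by
  obtain ⟨n, rfl⟩ : ∃ n, d = n + 1 := ⟨d - 1, by omega⟩
  have hi := i.isLt
  have hj := j.isLt
  have hval : ((finRotate (n + 1) ^ 2) i : ℕ) = if (i : ℕ) + 2 < n + 1 then (i : ℕ) + 2
      else (i : ℕ) + 2 - (n + 1) := by
    rw [pow_two, Equiv.Perm.mul_apply, coe_finRotate, coe_finRotate]
    simp only [Fin.ext_iff, coe_finRotate, Fin.val_last]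
    split_ifs <;> omega
  rw [Fin.ext_iff, hval]
  simp only [offset, winding]
  split_ifs <;> omega

lemma sum_offset (σ : Equiv.Perm (Fin d)) :
    ∑ i, offset (σ i) i = d * totalWinding σ := by
  simp only [offset, totalWinding, Finset.sum_add_distrib, Finset.sum_sub_distrib, Finset.mul_sum]
  rw [Equiv.sum_comp σ fun i => ((i : ℕ) : ℤ)]
  ring

lemma totalWinding_mem_Icc (hd : 6 ≤ d) {σ : Equiv.Perm (Fin d)}
    (h : ∏ i, coeffMatrix d q r p (σ i) i ≠ 0) :
    totalWinding σ ∈ Finset.Icc (-2 : ℤ) 2 := by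
  rw [Finset.prod_ne_zero_iff] at h
  have hs : |(d : ℤ) * totalWinding σ| ≤ d * 2 := by
    rw [← sum_offset]
    calc _ ≤ ∑ i, |offset (σ i) i| := Finset.abs_sum_le_sum_abs _ _
      _ ≤ ∑ _i : Fin d, 2 := Finset.sum_le_sum fun i hi => abs_offset_le hd (h i hi)
      _ = _ := by simp
  rw [abs_mul, Nat.abs_cast] at hs
  exact Finset.mem_Icc.2 (abs_le.1 (le_of_mul_le_mul_left hs (by omega)))

lemma det_eq_sum_detCoeff (hd : 6 ≤ d) (z : ℂ) {w : ℂ} (hw : w ≠ 0) :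
    (Jmat d q r p w - z • (1 : Matrix (Fin d) (Fin d) ℂ)).det =
      ∑ m ∈ Finset.Icc (-2 : ℤ) 2, (detCoeff d q r p m).eval z * w ^ m := by
  have hterm (σ : Equiv.Perm (Fin d)) :
      ∏ i, (Jmat d q r p w - z • (1 : Matrix (Fin d) (Fin d) ℂ)) (σ i) i =
        (∏ i, coeffMatrix d q r p (σ i) i).eval z * w ^ totalWinding σ := by
    simp only [sub_smul_one_apply_eq hd, Finset.prod_mul_distrib, eval_prod, totalWinding]
    congr 1
    induction (Finset.univ : Finset (Fin d)) using Finset.induction_on with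
    | empty => simp
    | insert a s ha ih => rw [Finset.prod_insert ha, Finset.sum_insert ha, zpow_add₀ hw, ih]
  rw [Matrix.det_apply']
  simp only [hterm, detCoeff, eval_finsetSum, Finset.sum_mul, Finset.sum_filter,
    apply_ite (eval z), eval_zero, ite_mul, zero_mul]
  rw [Finset.sum_comm]
  refine Finset.sum_congr rfl fun σ _ => ?_
  rw [Finset.sum_ite_eq]
  split_ifs with h
  · simp [mul_assoc]
  · rw [not_imp_comm.1 (totalWinding_mem_Icc hd) h]
    simp

lemma detCoeff_two_mul (hd : 6 ≤ d) {ε : ℤ} (hε : ε = 1 ∨ ε = -1) {τ : Equiv.Perm (Fin d)}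
    (hτ : ∀ i j, τ j = i ↔ offset i j = 2 * ε) :
    detCoeff d q r p (2 * ε) =
      (Equiv.Perm.sign τ : ℤ) * ∏ i, coeffMatrix d q r p (τ i) i := by
  have hεε : ε * ε = 1 := by rcases hε with rfl | rfl <;> norm_num
  refine Finset.sum_eq_single_of_mem τ ?_ fun σ hσ hne => ?_
  · have h := sum_offset τ
    simp only [(hτ _ _).1 rfl, Finset.sum_const, Finset.card_univ, Fintype.card_fin,
      nsmul_eq_mul] at h
    simpa using (mul_left_cancel₀ (by omega) h).symm
  · replace hσ : totalWinding σ = 2 * ε := by simpa using hσ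
    by_contra hprod
    have hc := Finset.prod_ne_zero_iff.1 (right_ne_zero_of_mul hprod)
    have hnonneg : ∀ i ∈ Finset.univ, 0 ≤ 2 - ε * offset (σ i) i := fun i hi => by
      have := abs_le.1 (abs_offset_le hd (hc i hi))
      rcases hε with rfl | rfl <;> omega
    have hsum : ∑ i, (2 - ε * offset (σ i) i) = 0 := by
      rw [Finset.sum_sub_distrib, ← Finset.mul_sum, sum_offset, hσ]
      simp
      linear_combination (-2 * (d : ℤ)) * hεε
    refine hne (Equiv.ext fun i => ((hτ _ _).2 ?_).symm)
    have := (Finset.sum_eq_zero_iff_of_nonneg hnonneg).1 hsum i (Finset.mem_univ i)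
    rcases hε with rfl | rfl <;> omega

lemma detCoeff_two (hd : 6 ≤ d) :
    detCoeff d q r p 2 = C (∏ j ∈ Finset.range d, (r j : ℂ)) := by
  have hτ (i j : Fin d) : (finRotate d ^ 2)⁻¹ j = i ↔ offset i j = 2 * 1 := by
    rw [Equiv.Perm.inv_eq_iff_eq, eq_comm, finRotate_sq_apply_eq_iff hd, mul_one]
  have h := detCoeff_two_mul (q := q) (r := r) (p := p) hd (Or.inl rfl) hτ
  simp only [coeffMatrix_of_offset_eq_two hd ((hτ _ _).1 rfl)] at h
  rw [mul_one] at h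
  rw [h, Finset.prod_range, map_prod]
  simp [Int.units_sq]

lemma detCoeff_neg_two (hd : 6 ≤ d) :
    detCoeff d q r p (-2) = C (∏ j ∈ Finset.range d, (r j : ℂ)) := by
  have hτ (i j : Fin d) : (finRotate d ^ 2) j = i ↔ offset i j = 2 * -1 := by
    rw [finRotate_sq_apply_eq_iff hd, offset_swap]
    omega
  have h := detCoeff_two_mul (q := q) (r := r) (p := p) hd (Or.inr rfl) hτ
  simp only [coeffMatrix_of_offset_eq_neg_two hd ((hτ _ _).1 rfl)] at h
  rw [Equiv.prod_comp (finRotate d ^ 2) fun i : Fin d => C (r i : ℂ)] at h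
  rw [show (-2 : ℤ) = 2 * -1 by norm_num, h, Finset.prod_range, map_prod]
  simp [Int.units_sq]

end Floquet

/-- There exist polynomials a, a*, b ∈ ℂ[z] such that for all z and all w ≠ 0:
det(j(w) − z·I) = R·w² + a(z)·w + b(z) + a*(z)·w⁻¹ + R·w⁻², where R = ∏_{j=0}^{d−1} r_j;
in particular, as a Laurent polynomial in w, det(j(w) − z·I) has degree at most 2 and at
least −2, and its coefficients at w² and w⁻² both equal R and do not depend on z. -/
theorem stmt6 (k : ℕ) (d : ℕ) (hd : d = 2 * k) (hd6 : 6 ≤ d)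
    (q r : ℕ → ℝ) (p : ℕ → ℂ) :
    ∃ a astar b : Polynomial ℂ, ∀ z w : ℂ, w ≠ 0 →
      Matrix.det (Jmat d q r p w - z • 1) =
        (∏ j ∈ Finset.range d, (r j : ℂ)) * w ^ 2 + a.eval z * w + b.eval z
          + astar.eval z * w⁻¹ + (∏ j ∈ Finset.range d, (r j : ℂ)) * w⁻¹ ^ 2 := by
  refine ⟨Floquet.detCoeff d q r p 1, Floquet.detCoeff d q r p (-1),
    Floquet.detCoeff d q r p 0, fun z w hw => ?_⟩
  rw [Floquet.det_eq_sum_detCoeff hd6 z hw,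
    show Finset.Icc (-2 : ℤ) 2 = {2, 1, 0, -1, -2} by decide]
  have hneg : w ^ (-2 : ℤ) = w⁻¹ ^ 2 := by
    rw [zpow_neg, inv_pow]
    rfl
  have hpos : w ^ (2 : ℤ) = w ^ 2 := rfl
  simp [Floquet.detCoeff_two hd6, Floquet.detCoeff_neg_two hd6, hneg, hpos, eval_prod]
  ring
end
end

section
/- Let b(z) denote the coefficient of w⁰ in the Laurent expansion in w of det( j(w) − z·I ) (a polynomial in z). Then b(z) − ∏_{i=0}^{d−1}(q_i − z) is a polynomial of degree at most d − 2; in particular, since d = 2k is even, b is a monic polynomial of degree 2k, so that B(z) := b(z)/∏_{j=0}^{d−1} r_j satisfies B(z) = z^{2k}/∏_{j=0}^{2k−1} r_j + (terms of degree ≤ 2k−1). -/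
noncomputable section

open Polynomial

lemma Jmat_apply_self (d : ℕ) (q r : ℕ → ℝ) (p : ℕ → ℂ) (w : ℂ) (i : Fin d) :
    Jmat d q r p w i i = (q i : ℂ) := by
  simp [Jmat]

lemma prod_C_sub_X_eq_of_even {R : Type*} [CommRing R] {d : ℕ} (hd : Even d) (f : ℕ → R) :
    ∏ i ∈ Finset.range d, (C (f i) - X) = ∏ i ∈ Finset.range d, (X - C (f i)) := by
  have h : ∀ i, C (f i) - X = -(X - C (f i)) := fun i => by ring
  simp only [h, Finset.prod_neg, Finset.card_range, hd.neg_one_pow, one_mul]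

lemma det_sub_smul_one_eq_eval_charpoly {R : Type*} [CommRing R] {d : ℕ} (hd : Even d)
    (M : Matrix (Fin d) (Fin d) R) (z : R) :
    (M - z • 1).det = M.charpoly.eval z := by
  rw [Matrix.eval_charpoly, ← neg_sub, Matrix.det_neg, Fintype.card_fin, hd.neg_one_pow, one_mul,
    Matrix.scalar_apply, Matrix.smul_one_eq_diagonal]

lemma degree_charpoly_Jmat_sub_lt {d : ℕ} (q r : ℕ → ℝ) (p : ℕ → ℂ) (w : ℂ) :
    ((Jmat d q r p w).charpoly - ∏ i ∈ Finset.range d, (X - C (q i : ℂ))).degree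
      < (d - 1 : ℕ) := by
  have h := Matrix.charpoly_sub_diagonal_degree_lt (Jmat d q r p w)
  simpa only [Jmat_apply_self, Fintype.card_fin,
    ← Finset.prod_range (fun i => X - C (q i : ℂ))] using h

/-- Let b(z) denote the coefficient of w⁰ in the Laurent expansion in w of det(j(w) − z·I)
(a polynomial in z).  Then b(z) − ∏_{i=0}^{d−1}(q_i − z) is a polynomial of degree at most
d − 2; in particular, since d = 2k is even, b is monic of degree 2k. -/
theorem stmt7 (k : ℕ) (d : ℕ) (hd : d = 2 * k) (hd6 : 6 ≤ d)
    (q r : ℕ → ℝ) (p : ℕ → ℂ)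
    (a astar b : Polynomial ℂ)
    (hdet : ∀ z w : ℂ, w ≠ 0 →
      Matrix.det (Jmat d q r p w - z • 1) =
        (∏ j ∈ Finset.range d, (r j : ℂ)) * w ^ 2 + a.eval z * w + b.eval z
          + astar.eval z * w⁻¹ + (∏ j ∈ Finset.range d, (r j : ℂ)) * w⁻¹ ^ 2) :
    (b - ∏ i ∈ Finset.range d, (Polynomial.C (q i : ℂ) - Polynomial.X)).degree
        ≤ (d - 2 : ℕ) ∧
    b.Monic ∧ b.natDegree = 2 * k := by
  have hev : Even d := ⟨k, by omega⟩
  rw [prod_C_sub_X_eq_of_even hev (fun i => (q i : ℂ))]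
  set P : ℂ[X] := ∏ i ∈ Finset.range d, (X - C (q i : ℂ)) with hP
  have hlt := degree_charpoly_Jmat_sub_lt (d := d) q r p
  rw [← hP] at hlt
  -- averaging over the fourth roots of unity isolates the coefficient of `w ^ 0`
  have havg : b - P = C (4⁻¹ : ℂ) *
      ((((Jmat d q r p 1).charpoly - P) + ((Jmat d q r p (-1)).charpoly - P)) +
        (((Jmat d q r p Complex.I).charpoly - P) +
          ((Jmat d q r p (-Complex.I)).charpoly - P))) := by
    refine Polynomial.funext fun z => ?_
    have h1 := hdet z 1 one_ne_zero
    have h2 := hdet z (-1) (neg_ne_zero.mpr one_ne_zero)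
    have h3 := hdet z Complex.I Complex.I_ne_zero
    have h4 := hdet z (-Complex.I) (neg_ne_zero.mpr Complex.I_ne_zero)
    rw [det_sub_smul_one_eq_eval_charpoly hev] at h1 h2 h3 h4
    simp only [eval_sub, eval_mul, eval_add, eval_C, h1, h2, h3, h4, inv_neg, inv_one,
      Complex.inv_I, neg_sq, Complex.I_sq]
    ring
  have hdeg : (b - P).degree < (d - 1 : ℕ) := by
    rw [havg, degree_C_mul (by norm_num)]
    refine (degree_add_le _ _).trans_lt (max_lt ?_ ?_) <;>
      exact (degree_add_le _ _).trans_lt (max_lt (hlt _) (hlt _))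
  have hPm : P.Monic := monic_prod_of_monic _ _ fun i _ => monic_X_sub_C _
  have hPn : P.natDegree = d := by
    rw [hP, natDegree_prod_of_monic _ _ fun i _ => monic_X_sub_C _]
    simp
  have hltP : (b - P).degree < P.degree := by
    rw [degree_eq_natDegree hPm.ne_zero, hPn]
    exact hdeg.trans_le (by exact_mod_cast Nat.sub_le d 1)
  have hb : b = P + (b - P) := by ring
  refine ⟨?_, ?_, ?_⟩
  · rw [degree_le_iff_coeff_zero]
    intro m hm
    refine coeff_eq_zero_of_degree_lt (hdeg.trans_le ?_)
    have hm' : d - 2 < m := by exact_mod_cast hm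
    exact_mod_cast (by omega : d - 1 ≤ m)
  · rw [hb]
    exact hPm.add_of_left hltP
  · rw [hb, natDegree_add_eq_left_of_degree_lt hltP, hPn, hd]
end
end

section
/- Let a(z) and a*(z) denote, respectively, the coefficients of w¹ and w⁻¹ in the Laurent expansion in w of det( j(w) − z·I ) (both polynomials in z). Then a and a* have degree at most k, and the coefficient of z^k in each of a and a* equals −( ∏_{j=0}^{k−1} r_{2j} + ∏_{j=0}^{k−1} r_{2j+1} ); equivalently, A*(z) := a*(z)/∏_{j=0}^{d−1} r_j satisfies A*(z) = ( −1/∏_{j=0}^{k−1} r_{2j} − 1/∏_{j=0}^{k−1} r_{2j+1} )·z^k + (terms of degree ≤ k−1), provided all r_j ≠ 0. -/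
noncomputable section

open Polynomial

/-- The weighted cyclic shift on `Fin n`, with entry `c j` in column `j` at row `j - 1` (cyclically). -/
def cyclicShift {R : Type*} [CommRing R] (n : ℕ) (c : ℕ → R) : Matrix (Fin n) (Fin n) R :=
  Matrix.of fun i j =>
    if (j : ℕ) = (i : ℕ) + 1 then c j
    else if (i : ℕ) = n - 1 ∧ (j : ℕ) = 0 then c 0 else 0

theorem cyclicShift_charpoly {R : Type*} [CommRing R] {n : ℕ} (hn : 2 ≤ n) (c : ℕ → R) :
    (cyclicShift n c).charpoly = X ^ n - C (∏ j ∈ Finset.range n, c j) := by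
  obtain ⟨n, rfl⟩ : ∃ m, n = m + 1 := ⟨n - 1, by omega⟩
  rw [Matrix.charpoly, Matrix.det_succ_column_zero]
  have hupper : ((cyclicShift (n + 1) c).charmatrix.submatrix (Fin.succAbove 0) Fin.succ).det
      = X ^ n := by
    rw [Matrix.det_of_isUpperTriangular]
    · simp [cyclicShift]
    · intro i j hij
      have : (j : ℕ) < i := hij
      have h1 : i ≠ j := by rintro rfl; omega
      simp [cyclicShift, h1]
      omega
  have hlower : ((cyclicShift (n + 1) c).charmatrix.submatrix
      (Fin.succAbove (Fin.last n)) Fin.succ).det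
      = (-1) ^ n * C (∏ j ∈ Finset.range n, c (j + 1)) := by
    rw [Matrix.det_of_isLowerTriangular]
    · have h (i : Fin n) : i.castSucc ≠ i.succ := Fin.castSucc_lt_succ.ne
      simp [cyclicShift, h, Finset.prod_neg, Finset.prod_range,
        map_prod]
    · intro i j hij
      have : (i : ℕ) < j := hij
      have h1 : i.castSucc ≠ j.succ := by
        intro h
        have := congrArg Fin.val h
        simp at this
        omega
      simp [cyclicShift, h1]
      omega
  rw [Finset.sum_eq_add_of_mem (0 : Fin (n + 1)) (Fin.last n) (Finset.mem_univ _)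
    (Finset.mem_univ _)]
  · rw [hupper, hlower, Finset.prod_range_succ']
    have h1 : Fin.last n ≠ 0 := by
      intro h
      have := congrArg Fin.val h
      simp at this
      omega
    have h3 : 0 ≠ n := by omega
    have h2 : ((-1 : R[X]) ^ n) * (-1) ^ n = 1 := by rw [← mul_pow]; simp
    simp [cyclicShift, h1, h3]
    linear_combination (-C (c 0) * ∏ x ∈ Finset.range n, C (c (x + 1))) * h2
  · intro h
    have := congrArg Fin.val h
    simp at this
    omega
  · rintro i - ⟨h0, h1⟩
    have : (i : ℕ) ≠ n := fun h => h1 (Fin.ext h)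
    simp [cyclicShift, h0, this]

/-- The matrix `Jmat`, conjugated by a diagonal matrix and rescaled so as to depend polynomially
on the variable `t`, where `w = t ^ (-d)`. -/
def gaugedJmat (d : ℕ) (q r : ℕ → ℝ) (p : ℕ → ℂ) : Matrix (Fin d) (Fin d) ℂ[X] :=
  Matrix.of fun i j =>
    if (i : ℕ) = (j : ℕ) then C (q i : ℂ) * X ^ 2
    else if (j : ℕ) = (i : ℕ) + 1 then C ((starRingEnd ℂ) (p j)) * X
    else if (i : ℕ) = d - 1 ∧ (j : ℕ) = 0 then C ((starRingEnd ℂ) (p 0)) * X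
    else if (i : ℕ) = (j : ℕ) + 1 then C (p i) * X ^ 3
    else if (i : ℕ) = 0 ∧ (j : ℕ) = d - 1 then C (p 0) * X ^ 3
    else if (j : ℕ) = (i : ℕ) + 2 then C (r j : ℂ)
    else if (i : ℕ) = d - 2 ∧ (j : ℕ) = 0 then C (r 0 : ℂ)
    else if (i : ℕ) = d - 1 ∧ (j : ℕ) = 1 then C (r 1 : ℂ)
    else if (i : ℕ) = (j : ℕ) + 2 then C (r i : ℂ) * X ^ 4
    else if (i : ℕ) = 0 ∧ (j : ℕ) = d - 2 then C (r 0 : ℂ) * X ^ 4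
    else if (i : ℕ) = 1 ∧ (j : ℕ) = d - 1 then C (r 1 : ℂ) * X ^ 4
    else 0

theorem mul_eval_ite_eq {R : Type*} [CommRing R] {c : Prop} {_ : Decidable c} {f g : R[X]}
    {x y s u t : R} (hg : s * evalRingHom t g = u * y) (hf : c → s * evalRingHom t f = u * x) :
    s * evalRingHom t (if c then f else g) = u * if c then x else y := by
  split_ifs with h
  exacts [hf h, hg]

theorem gaugedJmat_apply {d : ℕ} (hd : 2 ≤ d) (q r : ℕ → ℝ) (p : ℕ → ℂ) {t : ℂ} (ht : t ≠ 0)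
    (i j : Fin d) :
    t ^ (j : ℕ) * (gaugedJmat d q r p).map (evalRingHom t) i j
      = t ^ ((i : ℕ) + 2) * Jmat d q r p (t ^ d)⁻¹ i j := by
  obtain ⟨n, rfl⟩ : ∃ m, d = m + 2 := ⟨d - 2, by omega⟩
  have h1 : n + 2 - 1 = n + 1 := rfl
  simp only [Matrix.map_apply, gaugedJmat, Jmat, Matrix.of_apply, h1, Nat.add_sub_cancel]
  generalize (i : ℕ) = i
  generalize (j : ℕ) = j
  iterate 11 refine mul_eval_ite_eq ?_ fun h => ?_
  · simp
  all_goals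
    first
    | subst h
    | obtain ⟨rfl, rfl⟩ := h
    simp
    try field_simp
    try ring

theorem det_Jmat_eq {d : ℕ} (hd : 2 ≤ d) (hev : Even d) (q r : ℕ → ℝ) (p : ℕ → ℂ) {t : ℂ}
    (ht : t ≠ 0) (z : ℂ) :
    ((gaugedJmat d q r p).map (evalRingHom t)).charpoly.eval (t ^ 2 * z)
      = t ^ (2 * d) * (Jmat d q r p (t ^ d)⁻¹ - z • 1).det := by
  set B := (gaugedJmat d q r p).map (evalRingHom t)
  have hB : (∏ i : Fin d, t ^ (i : ℕ)) * (B - (t ^ 2 * z) • 1).det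
      = (∏ i : Fin d, t ^ ((i : ℕ) + 2)) * (Jmat d q r p (t ^ d)⁻¹ - z • 1).det := by
    rw [← Matrix.det_mul_row, ← Matrix.det_mul_column]
    congr 1
    ext i j
    simp only [Matrix.of_apply, Matrix.sub_apply, mul_sub, Matrix.smul_apply,
      B, gaugedJmat_apply hd q r p ht]
    congr 1
    by_cases h : i = j
    · subst h
      simp
      ring
    · simp [h]
  have hne : (∏ i : Fin d, t ^ (i : ℕ)) ≠ 0 := Finset.prod_ne_zero_iff.2 fun i _ => pow_ne_zero _ ht
  have hsplit : (∏ i : Fin d, t ^ ((i : ℕ) + 2)) = (∏ i : Fin d, t ^ (i : ℕ)) * t ^ (2 * d) := by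
    simp [pow_add, Finset.prod_mul_distrib, pow_mul]
  rw [hsplit, mul_assoc] at hB
  rw [← mul_left_cancel₀ hne hB, Matrix.eval_charpoly, ← neg_sub, Matrix.det_neg]
  simp [hev.neg_one_pow, ← Matrix.smul_one_eq_diagonal]

theorem gaugedJmat_zero_apply {d : ℕ} (hd : 6 ≤ d) (q r : ℕ → ℝ) (p : ℕ → ℂ) (i j : Fin d) :
    (gaugedJmat d q r p).map (evalRingHom 0) i j =
      if (j : ℕ) = (i : ℕ) + 2 then (r j : ℂ)
      else if (i : ℕ) = d - 2 ∧ (j : ℕ) = 0 then (r 0 : ℂ)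
      else if (i : ℕ) = d - 1 ∧ (j : ℕ) = 1 then (r 1 : ℂ) else 0 := by
  simp only [Matrix.map_apply, gaugedJmat, Matrix.of_apply, apply_ite (eval (0 : ℂ)),
    coe_evalRingHom, eval_mul, eval_C, eval_pow, eval_X, eval_zero, mul_zero, ne_eq,
    OfNat.ofNat_ne_zero, not_false_eq_true, zero_pow, ite_self]
  have hi := i.2
  have hj := j.2
  generalize (i : ℕ) = i at *
  generalize (j : ℕ) = j at *
  grind (splits := 30)

theorem gaugedJmat_zero_charpoly {k : ℕ} (hk : 3 ≤ k) (q r : ℕ → ℝ) (p : ℕ → ℂ) :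
    ((gaugedJmat (2 * k) q r p).map (evalRingHom 0)).charpoly
      = (X ^ k - C (∏ j ∈ Finset.range k, (r (2 * j) : ℂ)))
        * (X ^ k - C (∏ j ∈ Finset.range k, (r (2 * j + 1) : ℂ))) := by
  let e : Fin k × Fin 2 ≃ Fin (2 * k) := finProdFinEquiv.trans (finCongr (mul_comm k 2))
  have he (x : Fin k × Fin 2) : (e x : ℕ) = 2 * x.1 + x.2 := by simp [e, add_comm]
  have hblock : ((gaugedJmat (2 * k) q r p).map (evalRingHom 0)).charmatrix.submatrix e e
      = Matrix.blockDiagonal fun o : Fin 2 =>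
        (cyclicShift k fun j => (r (2 * j + o) : ℂ)).charmatrix := by
    ext1 ⟨i, a⟩ ⟨j, b⟩
    rw [Matrix.submatrix_apply, Matrix.charmatrix_apply, Matrix.blockDiagonal_apply,
      Matrix.charmatrix_apply]
    simp only [Matrix.diagonal_apply, e.injective.eq_iff, Prod.mk.injEq,
      gaugedJmat_zero_apply (show 6 ≤ 2 * k by omega), cyclicShift, Matrix.of_apply, he]
    have hi := i.2
    have hj := j.2
    fin_cases a <;> fin_cases b <;> simp [Fin.ext_iff]
    all_goals split_ifs <;> first | (exfalso; omega) | simp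
  rw [Matrix.charpoly, ← Matrix.det_submatrix_equiv_self e, hblock, Matrix.det_blockDiagonal,
    Fin.prod_univ_two]
  simp only [← Matrix.charpoly.eq_1]
  rw [cyclicShift_charpoly (by omega), cyclicShift_charpoly (by omega)]
  simp

theorem Jmat_transpose {d : ℕ} (hd : 6 ≤ d) (q r : ℕ → ℝ) (p : ℕ → ℂ) (w : ℂ) :
    (Jmat d q r p w).transpose = Jmat d q r (fun i => (starRingEnd ℂ) (p i)) w⁻¹ := by
  ext i j
  have hi := i.2
  have hj := j.2
  simp only [Matrix.transpose_apply, Jmat, Matrix.of_apply, div_inv_eq_mul, Complex.conj_conj,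
    ← div_eq_mul_inv]
  generalize (i : ℕ) = i at *
  generalize (j : ℕ) = j at *
  grind (splits := 30)

theorem coeff_of_det_Jmat {k d : ℕ} (hd : d = 2 * k) (hd6 : 6 ≤ d)
    (q r : ℕ → ℝ) (p : ℕ → ℂ) (a astar b : ℂ[X])
    (hdet : ∀ z w : ℂ, w ≠ 0 →
      Matrix.det (Jmat d q r p w - z • 1) =
        (∏ j ∈ Finset.range d, (r j : ℂ)) * w ^ 2 + a.eval z * w + b.eval z
          + astar.eval z * w⁻¹ + (∏ j ∈ Finset.range d, (r j : ℂ)) * w⁻¹ ^ 2) :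
    a.degree ≤ (k : ℕ) ∧
    a.coeff k = -((∏ j ∈ Finset.range k, (r (2 * j) : ℂ))
        + ∏ j ∈ Finset.range k, (r (2 * j + 1) : ℂ)) := by
  set R := ∏ j ∈ Finset.range d, (r j : ℂ)
  have hev : Even d := ⟨k, by omega⟩
  have hcomp {t : ℂ} (ht : t ≠ 0) :
      ((gaugedJmat d q r p).map (evalRingHom t)).charpoly.comp (C (t ^ 2) * X)
        = C (R + R * t ^ (4 * d)) + C (t ^ d) * a + C (t ^ (2 * d)) * b
          + C (t ^ (3 * d)) * astar := by
    refine Polynomial.funext fun z => ?_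
    have htd : t ^ d ≠ 0 := pow_ne_zero _ ht
    simp only [eval_comp, eval_mul, eval_C, eval_X, eval_add]
    rw [det_Jmat_eq (by omega) hev q r p ht, hdet z _ (inv_ne_zero htd)]
    simp only [mul_comm _ d, pow_mul]
    field_simp
    ring
  have hcoeff {m : ℕ} (hm : m ≠ 0) :
      (gaugedJmat d q r p).charpoly.coeff m * X ^ (2 * m)
        = C (a.coeff m) * X ^ d + C (b.coeff m) * X ^ (2 * d)
          + C (astar.coeff m) * X ^ (3 * d) := by
    refine mul_left_cancel₀ X_ne_zero (Polynomial.funext fun t => ?_)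
    rcases eq_or_ne t 0 with rfl | ht
    · simp
    have := congrArg (fun f => f.coeff m) (hcomp ht)
    simp only [comp_C_mul_X_coeff, coeff_add, coeff_C_mul, coeff_C_of_ne_zero hm,
      Matrix.charpoly_map, coeff_map, ← pow_mul] at this
    rw [coe_evalRingHom] at this
    simp only [eval_mul, eval_add, eval_C, eval_pow, eval_X, this]
    ring
  have hconst {m : ℕ} (hm : k ≤ m) : a.coeff m
      = ((gaugedJmat d q r p).charpoly.coeff m * X ^ (2 * m)).coeff d := by
    rw [hcoeff (by omega)]
    simp [coeff_X_pow, show d ≠ 2 * d by omega, show d ≠ 3 * d by omega]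
  constructor
  · refine (degree_le_iff_coeff_zero _ _).2 fun m hm => ?_
    have hm : k < m := by exact_mod_cast hm
    rw [hconst hm.le, coeff_mul_X_pow', if_neg (by omega)]
  · rw [hconst le_rfl, coeff_mul_X_pow', if_pos hd.ge, ← hd, Nat.sub_self,
      coeff_zero_eq_eval_zero, ← coe_evalRingHom, ← coeff_map, ← Matrix.charpoly_map]
    subst hd
    have hk : k ≠ 0 := by omega
    rw [gaugedJmat_zero_charpoly (by omega), sub_mul, mul_sub, mul_sub, ← C_mul, ← pow_add]
    simp only [coeff_sub, coeff_X_pow, coeff_mul_C, coeff_C_mul, coeff_C, hk,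
      show k ≠ k + k by omega, if_true, if_false]
    ring

/-- Let a(z) and a*(z) denote the coefficients of w¹ and w⁻¹ in the Laurent expansion in w of
det(j(w) − z·I).  Then a and a* have degree at most k, and the coefficient of z^k in each
equals −(∏_{j=0}^{k−1} r_{2j} + ∏_{j=0}^{k−1} r_{2j+1}). -/
theorem stmt8 (k : ℕ) (d : ℕ) (hd : d = 2 * k) (hd6 : 6 ≤ d)
    (q r : ℕ → ℝ) (p : ℕ → ℂ)
    (a astar b : Polynomial ℂ)
    (hdet : ∀ z w : ℂ, w ≠ 0 →
      Matrix.det (Jmat d q r p w - z • 1) =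
        (∏ j ∈ Finset.range d, (r j : ℂ)) * w ^ 2 + a.eval z * w + b.eval z
          + astar.eval z * w⁻¹ + (∏ j ∈ Finset.range d, (r j : ℂ)) * w⁻¹ ^ 2) :
    a.degree ≤ (k : ℕ) ∧ astar.degree ≤ (k : ℕ) ∧
    a.coeff k = -((∏ j ∈ Finset.range k, (r (2 * j) : ℂ))
        + ∏ j ∈ Finset.range k, (r (2 * j + 1) : ℂ)) ∧
    astar.coeff k = -((∏ j ∈ Finset.range k, (r (2 * j) : ℂ))
        + ∏ j ∈ Finset.range k, (r (2 * j + 1) : ℂ)) := by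
  obtain ⟨ha, hak⟩ := coeff_of_det_Jmat hd hd6 q r p a astar b hdet
  obtain ⟨hs, hsk⟩ := coeff_of_det_Jmat hd hd6 q r (fun i => (starRingEnd ℂ) (p i)) astar a b
    fun z w hw => by
      have h := hdet z w⁻¹ (inv_ne_zero hw)
      rw [← Matrix.det_transpose, Matrix.transpose_sub, Jmat_transpose hd6, inv_inv,
        Matrix.transpose_smul, Matrix.transpose_one] at h
      rw [h]
      ring
  exact ⟨ha, hs, hak, hsk⟩
end
end

section
/- Let h₀ > 0, let k ≥ 1 and m be integers with 1 ≤ m ≤ k, and let ω₀ be real with 0 ≤ ω₀ ≤ πm. Define θ : ℂ → ℂ by θ(u) = i·(u² + h₀²) − ω₀. Then θ restricts to a bijection from the set U := { u ∈ ℂ : Im u > 0, (Im u)² < (Re u)² + h₀², −ω₀ < 2·(Re u)·(Im u) < πm − ω₀ } onto the slit half-strip V := { θ ∈ ℂ : Im θ > 0, −πm < Re θ < 0 } \ { θ ∈ ℂ : Re θ = −ω₀, Im θ ≥ h₀² }. -/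
/-- A complex number off the closed positive real ray has a square root in the open upper
half-plane. -/
lemma Complex.exists_sq_eq_of_im_pos {w : ℂ} (hw : ¬(w.im = 0 ∧ 0 ≤ w.re)) :
    ∃ u : ℂ, 0 < u.im ∧ u ^ 2 = w := by
  obtain ⟨u, rfl⟩ := IsAlgClosed.exists_pow_nat_eq w (n := 2) two_pos
  rcases lt_trichotomy u.im 0 with h | h | h
  · exact ⟨-u, by simpa using h, neg_sq u⟩
  · exact absurd ⟨by simp [pow_two, h], by simp [pow_two, h, mul_self_nonneg]⟩ hw
  · exact ⟨u, h, rfl⟩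

/-- Let h₀ > 0, integers 1 ≤ m ≤ k, and 0 ≤ ω₀ ≤ πm.  The map θ(u) = i(u² + h₀²) − ω₀
restricts to a bijection from
U = { u : Im u > 0, (Im u)² < (Re u)² + h₀², −ω₀ < 2 Re u Im u < πm − ω₀ }
onto the slit half-strip
V = { θ : Im θ > 0, −πm < Re θ < 0 } \ { θ : Re θ = −ω₀, Im θ ≥ h₀² }. -/
theorem stmt10 (h₀ : ℝ) (hh₀ : 0 < h₀) (k m : ℕ) (hk : 1 ≤ k) (hm1 : 1 ≤ m) (hmk : m ≤ k)
    (ω₀ : ℝ) (hω₀ : 0 ≤ ω₀) (hω₀' : ω₀ ≤ Real.pi * m) :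
    Set.BijOn (fun u : ℂ => Complex.I * (u ^ 2 + (h₀ : ℂ) ^ 2) - (ω₀ : ℂ))
      { u : ℂ | 0 < u.im ∧ u.im ^ 2 < u.re ^ 2 + h₀ ^ 2 ∧
          -ω₀ < 2 * u.re * u.im ∧ 2 * u.re * u.im < Real.pi * m - ω₀ }
      ({ v : ℂ | 0 < v.im ∧ -(Real.pi * m) < v.re ∧ v.re < 0 } \
        { v : ℂ | v.re = -ω₀ ∧ h₀ ^ 2 ≤ v.im }) := by
  have re_eq (u : ℂ) : (Complex.I * (u ^ 2 + (h₀ : ℂ) ^ 2) - (ω₀ : ℂ)).re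
      = -(2 * u.re * u.im) - ω₀ := by
    simp [pow_two]; ring
  have im_eq (u : ℂ) : (Complex.I * (u ^ 2 + (h₀ : ℂ) ^ 2) - (ω₀ : ℂ)).im
      = u.re ^ 2 - u.im ^ 2 + h₀ ^ 2 := by
    simp [pow_two]
  refine ⟨?_, ?_, ?_⟩
  · rintro u ⟨hu, h1, h2, h3⟩
    simp only [Set.mem_sdiff, Set.mem_ofPred_eq, re_eq, im_eq]
    refine ⟨⟨by linarith, by linarith, by linarith⟩, ?_⟩
    rintro ⟨hre, him⟩
    have h0 : u.re * u.im = 0 := by linarith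
    have hre0 : u.re = 0 := (mul_eq_zero.mp h0).resolve_right hu.ne'
    rw [hre0] at him
    nlinarith [pow_pos hu 2]
  · rintro u ⟨hu, -⟩ v ⟨hv, -⟩ huv
    have hsq : u ^ 2 = v ^ 2 := by simpa using huv
    rcases sq_eq_sq_iff_eq_or_eq_neg.mp hsq with h | h
    · exact h
    · rw [h, Complex.neg_im] at hu
      linarith
  · rintro v ⟨⟨h1, h2, h3⟩, h4⟩
    obtain ⟨u, hu, hsq⟩ := Complex.exists_sq_eq_of_im_pos
      (w := -Complex.I * (v + ω₀) - (h₀ : ℂ) ^ 2) (by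
        rintro ⟨him, hre⟩
        simp [pow_two] at him hre
        exact h4 ⟨by linarith, by nlinarith⟩)
    have huv : Complex.I * (u ^ 2 + (h₀ : ℂ) ^ 2) - (ω₀ : ℂ) = v := by
      rw [hsq]
      linear_combination (-(v + ω₀)) * Complex.I_sq
    have hre := re_eq u
    have him := im_eq u
    rw [huv] at hre him
    exact ⟨u, ⟨hu, by linarith, by linarith, by linarith⟩, huv⟩
end

section
/- Let h₀ > 0, let k ≥ 1 and m be integers with 1 ≤ m ≤ k, and let ω₀ be real with 0 ≤ ω₀ ≤ πm. Define θ : ℂ → ℂ by θ(u) = i·(u² + h₀²) − ω₀. Then θ restricts to a bijection from the set U' := { u ∈ ℂ : Im u < 0, (Im u)² < (Re u)² + h₀², π(m−k) − ω₀ < 2·(Re u)·(Im u) < πk − ω₀ } onto the slit half-strip V' := { θ ∈ ℂ : Im θ > 0, −πk < Re θ < π(k−m) } \ { θ ∈ ℂ : Re θ = −ω₀, Im θ ≥ h₀² }. -/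
/-- Let h₀ > 0, integers 1 ≤ m ≤ k, and 0 ≤ ω₀ ≤ πm.  The map θ(u) = i(u² + h₀²) − ω₀
restricts to a bijection from
U' = { u : Im u < 0, (Im u)² < (Re u)² + h₀², π(m−k) − ω₀ < 2 Re u Im u < πk − ω₀ }
onto the slit half-strip
V' = { θ : Im θ > 0, −πk < Re θ < π(k−m) } \ { θ : Re θ = −ω₀, Im θ ≥ h₀² }. -/
theorem stmt11 (h₀ : ℝ) (hh₀ : 0 < h₀) (k m : ℕ) (hk : 1 ≤ k) (hm1 : 1 ≤ m) (hmk : m ≤ k)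
    (ω₀ : ℝ) (hω₀ : 0 ≤ ω₀) (hω₀' : ω₀ ≤ Real.pi * m) :
    Set.BijOn (fun u : ℂ => Complex.I * (u ^ 2 + (h₀ : ℂ) ^ 2) - (ω₀ : ℂ))
      { u : ℂ | u.im < 0 ∧ u.im ^ 2 < u.re ^ 2 + h₀ ^ 2 ∧
          Real.pi * ((m : ℝ) - (k : ℝ)) - ω₀ < 2 * u.re * u.im ∧
          2 * u.re * u.im < Real.pi * k - ω₀ }
      ({ v : ℂ | 0 < v.im ∧ -(Real.pi * k) < v.re ∧ v.re < Real.pi * ((k : ℝ) - (m : ℝ)) } \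
        { v : ℂ | v.re = -ω₀ ∧ h₀ ^ 2 ≤ v.im }) := by
  have hre (u : ℂ) : (Complex.I * (u ^ 2 + (h₀ : ℂ) ^ 2) - (ω₀ : ℂ)).re
      = -(2 * u.re * u.im) - ω₀ := by
    simp [pow_two]; ring
  have him (u : ℂ) : (Complex.I * (u ^ 2 + (h₀ : ℂ) ^ 2) - (ω₀ : ℂ)).im
      = u.re ^ 2 - u.im ^ 2 + h₀ ^ 2 := by
    simp [pow_two]
  refine ⟨?_, ?_, ?_⟩
  · rintro u ⟨h1, h2, h3, h4⟩
    refine ⟨⟨?_, ?_, ?_⟩, ?_⟩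
    · dsimp only; rw [him]; linarith
    · dsimp only; rw [hre]; linarith
    · dsimp only; rw [hre]; linarith
    · rintro ⟨h5, h6⟩
      dsimp only at h5 h6
      rw [hre] at h5
      rw [him] at h6
      have h7 : u.re * u.im = 0 := by linarith
      have h8 : u.re = 0 := (mul_eq_zero.mp h7).resolve_right h1.ne
      rw [h8] at h6
      nlinarith
  · rintro u ⟨hu, -⟩ w ⟨hw, -⟩ h
    have hsq : u ^ 2 = w ^ 2 :=
      add_right_cancel (mul_left_cancel₀ Complex.I_ne_zero (sub_left_injective h))
    rcases sq_eq_sq_iff_eq_or_eq_neg.mp hsq with h | h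
    · exact h
    · rw [h, Complex.neg_im] at hu
      linarith
  · rintro v ⟨⟨h1, h2, h3⟩, h4⟩
    obtain ⟨w, hw⟩ := IsAlgClosed.exists_pow_nat_eq
      (-Complex.I * (v + ω₀) - (h₀ : ℂ) ^ 2) two_pos
    have hv (u : ℂ) (hu : u ^ 2 = w ^ 2) :
        Complex.I * (u ^ 2 + (h₀ : ℂ) ^ 2) - (ω₀ : ℂ) = v := by
      rw [hu, hw]
      linear_combination -(v + ω₀) * Complex.I_sq
    have hw0 : w.im ≠ 0 := by
      intro h0
      have hr := hre w
      have hi := him w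
      rw [hv w rfl, h0] at hr hi
      exact h4 ⟨by linarith, by nlinarith⟩
    obtain ⟨u, hu, hu0⟩ : ∃ u : ℂ, u ^ 2 = w ^ 2 ∧ u.im < 0 := by
      rcases hw0.lt_or_gt with h | h
      · exact ⟨w, rfl, h⟩
      · exact ⟨-w, neg_sq w, by simpa using h⟩
    have hr := hre u
    have hi := him u
    rw [hv u hu] at hr hi
    exact ⟨u, ⟨hu0, by linarith, by linarith, by linarith⟩, hv u hu⟩
end
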